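/- arXiv:2506.10448 — 3 statements merged into one kernel-verified Lean document; each statement's English description precedes it below -/
import Mathlib

section
/- Let μ be a compactly supported Borel probability measure on ℝ^d, let V = (V_k) be an admissible sequence of open sets and let t ≥ 0. Then for every compact set K ⊆ X, the set J^μ_{V,t}(K) is a compact subset of X and J^μ_{V,t}(K) ⊆ K. -/
open MeasureTheory Metric Filter Set Pointwise ProbabilityTheory

noncomputable section

/-- `ℝ^d` with the Euclidean norm. -/
abbrev Ed (d : ℕ) := EuclideanSpace ℝ (Fin d)

/-- The topological support of a Borel measure. -/
def msupp {E : Type*} [PseudoMetricSpace E] [MeasurableSpace E] (μ : Measure E) : Set E :=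
  {x | ∀ r > 0, 0 < μ (ball x r)}

/-- The lower local dimension of a measure at a point. -/
def lowerLocalDim {E : Type*} [PseudoMetricSpace E] [MeasurableSpace E]
    (μ : Measure E) (x : E) : ℝ :=
  liminf (fun r : ℝ => Real.log (μ (ball x r)).toReal / Real.log r) (nhdsWithin 0 (Ioi 0))

/-- `D_μ(t)`: the sub-level set of the lower local dimension. -/
def Dset {E : Type*} [PseudoMetricSpace E] [MeasurableSpace E]
    (μ : Measure E) (t : ℝ) : Set E :=
  {x ∈ msupp μ | lowerLocalDim μ x ≤ t}

/-- `F_μ(t)`: the lower Hausdorff multifractal spectrum of the lower local dimension. -/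
def Fspec {E : Type*} [MetricSpace E] [MeasurableSpace E] (μ : Measure E) (t : ℝ) : ℝ :=
  (dimH (Dset μ t)).toReal

/-- Covering number of a set by `ε`-balls. -/
def coveringNumber {E : Type*} [PseudoMetricSpace E] (s : Set E) (ε : ℝ) : ℕ∞ :=
  ⨅ (t : Finset E) (_ : s ⊆ ⋃ x ∈ t, ball x ε), (t.card : ℕ∞)

/-- Upper box-counting (Minkowski) dimension. -/
def upperBoxDim {E : Type*} [PseudoMetricSpace E] (s : Set E) : ℝ :=
  limsup (fun n : ℕ => Real.log (coveringNumber s (1 / n)).toNat / Real.log n) atTop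

/-- Lower box-counting (Minkowski) dimension. -/
def lowerBoxDim {E : Type*} [PseudoMetricSpace E] (s : Set E) : ℝ :=
  liminf (fun n : ℕ => Real.log (coveringNumber s (1 / n)).toNat / Real.log n) atTop

/-- The packing dimension, defined as the modified upper box-counting dimension. -/
def packingDim {E : Type*} [PseudoMetricSpace E] (s : Set E) : ℝ :=
  sInf {y | ∃ F : ℕ → Set E, s ⊆ ⋃ n, F n ∧ ∀ n, upperBoxDim (F n) ≤ y}

/-- The modified lower box-counting dimension. -/
def modLowerBoxDim {E : Type*} [PseudoMetricSpace E] (s : Set E) : ℝ :=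
  sInf {y | ∃ F : ℕ → Set E, s ⊆ ⋃ n, F n ∧ ∀ n, lowerBoxDim (F n) ≤ y}

/-- `H_μ(t)`: the lower packing multifractal spectrum of the lower local dimension. -/
def Hspec {E : Type*} [PseudoMetricSpace E] [MeasurableSpace E] (μ : Measure E) (t : ℝ) : ℝ :=
  packingDim (Dset μ t)

/-- The increasing 1-Lipschitz hull of a function on `[0, ∞)`. -/
def lipHull (g : ℝ → ℝ) (t : ℝ) : ℝ :=
  sInf {y | ∃ h : ℝ → ℝ, Monotone h ∧ LipschitzWith 1 h ∧ (∀ s, 0 ≤ s → g s ≤ h s) ∧ y = h t}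

/-- The random covering set `E_r(ω) = limsup_k B(ω_k, r_k)`. -/
def coverSet {E : Type*} [PseudoMetricSpace E] {Ω : Type*}
    (Y : ℕ → Ω → E) (r : ℕ → ℝ) (ω : Ω) : Set E :=
  limsup (fun k => ball (Y k ω) (r k)) atTop

/-- The random covering set `E_α(ω)` with radii `k^{-α}`. -/
def coverSetα {E : Type*} [PseudoMetricSpace E] {Ω : Type*}
    (Y : ℕ → Ω → E) (α : ℝ) (ω : Ω) : Set E :=
  coverSet Y (fun k => (k : ℝ) ^ (-α)) ω

/-- The random covering set `E_V(ω) = limsup_k (ω_k + V_k)`. -/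
def coverSetV {E : Type*} [SeminormedAddCommGroup E] {Ω : Type*}
    (Y : ℕ → Ω → E) (V : ℕ → Set E) (ω : Ω) : Set E :=
  limsup (fun k => Y k ω +ᵥ V k) atTop

/-- A sequence of open sets is admissible: each contains `0` and the diameters tend to `0`. -/
def Admissible {E : Type*} [SeminormedAddCommGroup E] (V : ℕ → Set E) : Prop :=
  (∀ k, IsOpen (V k) ∧ (0 : E) ∈ V k) ∧
    Tendsto (fun k => EMetric.diam (V k)) atTop (nhds 0)

/-- The hitting operator `J^μ_{V,t}` relative to an ambient compact cube `Q`. -/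
def Jop {E : Type*} [SeminormedAddCommGroup E] [MeasurableSpace E]
    (μ : Measure E) (V : ℕ → Set E) (t : ℝ) (Q K : Set E) : Set E :=
  {x ∈ Q | ∀ r > 0, ∑' k, μ (ball x r ∩ (K - V k)) * ENNReal.ofReal (diam (V k) ^ t) = ⊤}

/-- The transfinite iterates `C_t^γ` of the hitting operator starting from `C`. -/
def iterJ {E : Type*} [SeminormedAddCommGroup E] [MeasurableSpace E]
    (μ : Measure E) (V : ℕ → Set E) (t : ℝ) (Q C : Set E) (γ : Ordinal) : Set E :=
  Ordinal.limitRecOn γ C (fun _ ih => Jop μ V t Q ih)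
    (fun o _ ih => ⋂ (γ' : Ordinal) (h : γ' < o), ih γ' h)

/-- The ball hitting operator `J^μ_{r,s}`, where `thickening (r k) K` is the open
`r_k`-neighbourhood `K(r_k)`. -/
def Jball {E : Type*} [PseudoMetricSpace E] [MeasurableSpace E]
    (μ : Measure E) (r : ℕ → ℝ) (s : ℝ) (K : Set E) : Set E :=
  {x | ∀ ρ > 0, ∑' k, μ (ball x ρ ∩ thickening (r k) K) * ENNReal.ofReal (r k ^ s) = ⊤}

/-- `s₂(r)`, the exponent of convergence of the sequence `r`. -/
def s2 (r : ℕ → ℝ) : ℝ := sInf {t | 0 < t ∧ Summable fun k => r k ^ t}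

/-- **Lemma 2.4**: for every compact `K ⊆ Q`, the set `J^μ_{V,t}(K)` is a compact subset of
the ambient cube `Q` and `J^μ_{V,t}(K) ⊆ K`. -/
theorem Jop_isCompact_subset
    (d : ℕ) (hd : 1 ≤ d) (μ : Measure (Ed d)) [IsProbabilityMeasure μ]
    (hμc : IsCompact (msupp μ))
    (V : ℕ → Set (Ed d)) (hV : Admissible V)
    (t : ℝ) (ht : 0 ≤ t)
    (Q : Set (Ed d)) (hQ : IsCompact Q) (hμQ : msupp μ ⊆ Q)
    (K : Set (Ed d)) (hK : IsCompact K) (hKQ : K ⊆ Q) :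
    IsCompact (Jop μ V t Q K) ∧ Jop μ V t Q K ⊆ Q ∧ Jop μ V t Q K ⊆ K := by
  have hsub : Jop μ V t Q K ⊆ Q := fun x hx => hx.1
  refine ⟨?_, hsub, ?_⟩
  · refine hQ.of_isClosed_subset (isClosed_of_closure_subset ?_) hsub
    intro x hx
    refine ⟨hQ.isClosed.closure_subset_iff.2 hsub hx, fun r hr => ?_⟩
    obtain ⟨y, hy, hxy⟩ := Metric.mem_closure_iff.1 hx (r / 2) (half_pos hr)
    have h := hy.2 (r / 2) (half_pos hr)
    rw [eq_top_iff, ← h]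
    refine ENNReal.tsum_le_tsum fun k => ?_
    have hb : ball y (r / 2) ⊆ ball x r := by
      apply ball_subset_ball'
      rw [dist_comm]
      linarith
    gcongr
  · intro x hx
    by_contra hxK
    obtain ⟨ε, hε, hball⟩ := Metric.isOpen_iff.1 hK.isClosed.isOpen_compl x hxK
    have hε2 : 0 < ε / 2 := half_pos hε
    have hev := hV.2.eventually (gt_mem_nhds (ENNReal.ofReal_pos.2 hε2))
    obtain ⟨N, hN⟩ := eventually_atTop.1 hev
    have h := hx.2 (ε / 2) hε2
    have hz : ∀ k ∉ Finset.range N,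
        μ (ball x (ε / 2) ∩ (K - V k)) * ENNReal.ofReal (diam (V k) ^ t) = 0 := by
      intro k hk
      have hk' : N ≤ k := by simpa using hk
      have he : ball x (ε / 2) ∩ (K - V k) = ∅ := by
        rw [Set.eq_empty_iff_forall_notMem]
        rintro z ⟨hz, a, ha, v, hv, rfl⟩
        have h1 : edist v 0 < ENNReal.ofReal (ε / 2) :=
          lt_of_le_of_lt (Metric.edist_le_ediam_of_mem hv (hV.1 k).2) (hN k hk')
        rw [edist_lt_ofReal] at h1
        refine hball (?_ : a ∈ ball x ε) ha
        have h2 : dist a (a - v) = dist v 0 := by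
          simp [dist_eq_norm]
        have h3 := dist_triangle a (a - v) x
        have h4 : dist (a - v) x < ε / 2 := hz
        rw [mem_ball]
        linarith
      rw [he]
      simp
    rw [tsum_eq_sum hz] at h
    refine absurd h (ENNReal.sum_ne_top.2 fun k _ => ?_)
    exact ENNReal.mul_ne_top (measure_ne_top _ _) ENNReal.ofReal_ne_top

end
end

section
/- Let (Ω̃, ℙ̃) be a probability space, let (A_n)_{n≥1} be a sequence of independent events, and let (a_n)_{n≥1} be a bounded sequence of positive real numbers. Suppose (N_n)_{n≥1} is a strictly increasing sequence of natural numbers (with N_0 := 0) such that E_n := ∑_{k=N_{n−1}+1}^{N_n} ℙ̃(A_k)·a_k > 0 for every n and ∑_{n=1}^∞ E_n^{−1} < ∞. Define S_n(ω̃) := ∑_{k=N_{n−1}+1}^{N_n} 1_{A_k}(ω̃)·a_k. Then S_n/E_n → 1 almost surely as n → ∞. -/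
open MeasureTheory Metric Filter Set Pointwise ProbabilityTheory

noncomputable section

/-- **Lemma 4.1**: for independent events `(A_k)` and a bounded sequence of positive weights
`(a_k)`, if the block sums `E_n = ∑_{k=N_{n-1}+1}^{N_n} ℙ(A_k) a_k` are positive and
`∑ E_n⁻¹ < ∞`, then `S_n / E_n → 1` almost surely, where
`S_n = ∑_{k=N_{n-1}+1}^{N_n} 1_{A_k} a_k`. -/
theorem block_sums_tendsto_one
    (Ω : Type) [MeasureSpace Ω] [IsProbabilityMeasure (ℙ : Measure Ω)]
    (A : ℕ → Set Ω) (hAm : ∀ k, MeasurableSet (A k))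
    (hAindep : iIndepSet A ℙ)
    (a : ℕ → ℝ) (hapos : ∀ k, 0 < a k) (habd : ∃ M : ℝ, ∀ k, a k ≤ M)
    (N : ℕ → ℕ) (hN0 : N 0 = 0) (hN : StrictMono N)
    (hEpos : ∀ n : ℕ, 0 < ∑ k ∈ Finset.Ioc (N n) (N (n + 1)), (ℙ (A k)).toReal * a k)
    (hEsum : Summable fun n : ℕ =>
      (∑ k ∈ Finset.Ioc (N n) (N (n + 1)), (ℙ (A k)).toReal * a k)⁻¹) :
    ∀ᵐ ω ∂ℙ, Tendsto
      (fun n : ℕ =>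
        (∑ k ∈ Finset.Ioc (N n) (N (n + 1)), (A k).indicator (fun _ => a k) ω) /
          ∑ k ∈ Finset.Ioc (N n) (N (n + 1)), (ℙ (A k)).toReal * a k)
      atTop (nhds 1) := by
  obtain ⟨M, hM⟩ := habd
  set X : ℕ → Ω → ℝ := fun k => (A k).indicator (fun _ => a k) with hX
  set E : ℕ → ℝ := fun n => ∑ k ∈ Finset.Ioc (N n) (N (n + 1)), (ℙ (A k)).toReal * a k with hE
  have hmem : ∀ k, MemLp (X k) 2 ℙ := fun k => memLp_indicator_const 2 (hAm k) _ (Or.inr (by simp))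
  have hind : iIndepFun X ℙ := by
    have h := (iIndepSet.iIndepFun_indicator (β := ℝ) hAindep).comp (fun k x => x * a k)
      (fun k => by fun_prop)
    convert h using 2 with k
    funext ω
    by_cases hω : ω ∈ A k <;> simp [hX, hω]
  have hint : ∀ k, ∫ ω, X k ω ∂ℙ = (ℙ (A k)).toReal * a k := fun k => by
    simp [hX, integral_indicator_const _ (hAm k), Measure.real]
  have hvar : ∀ k, variance (X k) ℙ ≤ M * ((ℙ (A k)).toReal * a k) := fun k => by
    refine (variance_le_expectation_sq (hmem k).1).trans ?_
    have h2 : (X k) ^ 2 = (A k).indicator (fun _ => a k ^ 2) := by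
      funext ω
      by_cases hω : ω ∈ A k <;> simp [hX, hω]
    rw [h2, integral_indicator_const _ (hAm k), Measure.real, smul_eq_mul]
    have h3 : a k * a k ≤ M * a k := mul_le_mul_of_nonneg_right (hM k) (hapos k).le
    have h4 := mul_le_mul_of_nonneg_left h3 (ENNReal.toReal_nonneg (a := ℙ (A k)))
    nlinarith
  have hcheb : ∀ ε : ℝ, 0 < ε → ∀ n, (ℙ : Measure Ω) {ω | ε * E n ≤
      |(∑ k ∈ Finset.Ioc (N n) (N (n + 1)), X k) ω - E n|} ≤
      ENNReal.ofReal (M / ε ^ 2 * (E n)⁻¹) := fun ε hε n => by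
    have hEn : 0 < E n := hEpos n
    have hm : MemLp (∑ k ∈ Finset.Ioc (N n) (N (n + 1)), X k) 2 ℙ :=
      memLp_finsetSum' _ fun k _ => hmem k
    have h := meas_ge_le_variance_div_sq hm (mul_pos hε hEn)
    have hmean : ∫ ω, (∑ k ∈ Finset.Ioc (N n) (N (n + 1)), X k) ω ∂ℙ = E n := by
      simp only [Finset.sum_apply]
      rw [integral_finsetSum _ fun k _ => (hmem k).integrable (by norm_num)]
      exact Finset.sum_congr rfl fun k _ => hint k
    rw [hmean] at h
    refine h.trans (ENNReal.ofReal_le_ofReal ?_)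
    have hv : variance (∑ k ∈ Finset.Ioc (N n) (N (n + 1)), X k) ℙ ≤ M * E n := by
      rw [IndepFun.variance_sum (fun k _ => hmem k) fun i _ j _ hij => hind.indepFun hij,
        hE, Finset.mul_sum]
      exact Finset.sum_le_sum fun k _ => hvar k
    calc _ ≤ M * E n / (ε * E n) ^ 2 := by gcongr
      _ = _ := by field_simp
  have hbc : ∀ ε : ℝ, 0 < ε → ∀ᵐ ω ∂(ℙ : Measure Ω), ∀ᶠ n in atTop, ¬ (ε * E n ≤
      |(∑ k ∈ Finset.Ioc (N n) (N (n + 1)), X k) ω - E n|) := fun ε hε => by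
    refine ae_eventually_notMem (ne_top_of_le_ne_top ?_ (ENNReal.tsum_le_tsum (hcheb ε hε)))
    exact (hEsum.mul_left (M / ε ^ 2)).tsum_ofReal_ne_top
  have hall : ∀ᵐ ω ∂(ℙ : Measure Ω), ∀ m : ℕ, ∀ᶠ n in atTop, ¬ ((1 / ((m : ℝ) + 1)) * E n ≤
      |(∑ k ∈ Finset.Ioc (N n) (N (n + 1)), X k) ω - E n|) :=
    ae_all_iff.2 fun m => hbc _ (by positivity)
  filter_upwards [hall] with ω hω
  rw [Metric.tendsto_nhds]
  intro ε hε
  obtain ⟨m, hm⟩ := exists_nat_one_div_lt hε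
  filter_upwards [hω m] with n hn
  have hEn : 0 < E n := hEpos n
  rw [not_le, Finset.sum_apply] at hn
  change |(∑ k ∈ Finset.Ioc (N n) (N (n + 1)), X k ω) / E n - 1| < ε
  rw [div_sub_one hEn.ne', abs_div, abs_of_pos hEn, div_lt_iff₀ hEn]
  exact hn.trans (mul_lt_mul_of_pos_right hm hEn)

end
end

section
/- Let L₁ be the restriction of one-dimensional Lebesgue measure to [0,1] and let r = (r_k) be a decreasing sequence of positive numbers with ∑_{k=1}^∞ r_k < ∞ and ∑_{k=1}^∞ √(r_k) = ∞. Then there exists a compact set K ⊆ [0,1] such that ⋂_{n=1}^∞ (J^{L₁}_r)^n(K) = {0}, where (J^{L₁}_r)^n denotes the n-th iterate of the hitting operator; consequently, since J^{L₁}_r({0}) = ∅, the transfinite iteration of J^{L₁}_r starting from K does not stabilize after finitely many or even ω many steps. -/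
open MeasureTheory Metric Filter Set Pointwise ProbabilityTheory

noncomputable section

/-- The measure used throughout. -/
abbrev muI : Measure ℝ := volume.restrict (Icc (0 : ℝ) 1)

theorem Jm_mem {r : ℕ → ℝ} {A : Set ℝ} {x : ℝ} :
    x ∈ Jball muI r 0 A ↔ ∀ ρ > 0, ∑' k, muI (ball x ρ ∩ thickening (r k) A) = ⊤ := by
  simp [Jball]

theorem Jm_mono {r : ℕ → ℝ} : Monotone (fun A : Set ℝ => Jball muI r 0 A) := by
  intro A B h x hx
  rw [Jm_mem] at hx ⊢
  intro ρ hρ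
  refine top_unique ?_
  rw [← hx ρ hρ]
  refine ENNReal.tsum_le_tsum fun k => ?_
  exact measure_mono (inter_subset_inter_right _ (thickening_subset_of_subset _ h))

theorem Jm_union {r : ℕ → ℝ} (A B : Set ℝ) :
    Jball muI r 0 (A ∪ B) ⊆ Jball muI r 0 A ∪ Jball muI r 0 B := by
  intro x hx
  by_contra hcon
  simp only [mem_union, not_or, Jm_mem, not_forall] at hcon
  obtain ⟨⟨ρ, hρ, h1⟩, ⟨σ, hσ, h2⟩⟩ := hcon
  rw [Jm_mem] at hx
  have h3 := hx (min ρ σ) (lt_min hρ hσ)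
  have : ∑' k, muI (ball x (min ρ σ) ∩ thickening (r k) (A ∪ B)) ≤
      ∑' k, muI (ball x ρ ∩ thickening (r k) A) + ∑' k, muI (ball x σ ∩ thickening (r k) B) := by
    rw [← ENNReal.tsum_add]
    refine ENNReal.tsum_le_tsum fun k => ?_
    refine le_trans (measure_mono ?_) (measure_union_le _ _)
    rw [thickening_union, inter_union_distrib_left]
    exact union_subset_union
      (inter_subset_inter_left _ (ball_subset_ball (min_le_left _ _)))
      (inter_subset_inter_left _ (ball_subset_ball (min_le_right _ _)))
  rw [h3] at this
  exact (ENNReal.add_ne_top.2 ⟨h1, h2⟩) (top_unique this)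

theorem Jm_closed {r : ℕ → ℝ} (A : Set ℝ) : IsClosed (Jball muI r 0 A) := by
  refine isClosed_of_closure_subset fun x hx => ?_
  rw [Jm_mem]
  intro ρ hρ
  obtain ⟨y, hy, hxy⟩ := Metric.mem_closure_iff.1 hx (ρ / 2) (by positivity)
  rw [Jm_mem] at hy
  refine top_unique ?_
  rw [← hy (ρ / 2) (by positivity)]
  refine ENNReal.tsum_le_tsum fun k => ?_
  refine measure_mono (inter_subset_inter_left _ (ball_subset_ball' ?_))
  rw [dist_comm]
  linarith

theorem Jm_sub {r : ℕ → ℝ} (hsum : Summable r) {A : Set ℝ} (hA : IsClosed A) :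
    Jball muI r 0 A ⊆ A := by
  intro x hx
  by_contra hxA
  obtain ⟨ε, hε, hball⟩ := Metric.isOpen_iff.1 hA.isOpen_compl x hxA
  rw [Jm_mem] at hx
  have h1 := hx (ε / 2) (by positivity)
  have h2 : ∀ᶠ k in atTop, r k < ε / 2 :=
    hsum.tendsto_atTop_zero.eventually (gt_mem_nhds (by positivity))
  obtain ⟨N, hN⟩ := eventually_atTop.1 h2
  have h3 : ∀ k ∉ Finset.range N, muI (ball x (ε / 2) ∩ thickening (r k) A) = 0 := by
    intro k hk
    have hk' : N ≤ k := by simpa using hk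
    have : ball x (ε / 2) ∩ thickening (r k) A = ∅ := by
      refine eq_empty_of_forall_notMem ?_
      rintro y ⟨hy1, hy2⟩
      obtain ⟨z, hz, hyz⟩ := mem_thickening_iff.1 hy2
      have hzb : z ∈ ball x ε := by
        rw [mem_ball] at hy1 ⊢
        have := dist_triangle z y x
        rw [dist_comm z y] at this
        linarith [hN k hk']
      exact hball hzb hz
    rw [this, measure_empty]
  rw [tsum_eq_sum h3] at h1
  exact (ENNReal.sum_ne_top.2 fun k _ => measure_ne_top _ _) h1

theorem Jm_singleton {r : ℕ → ℝ} (hrpos : ∀ k, 0 < r k) (hsum : Summable r) (x : ℝ) :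
    Jball muI r 0 {x} = ∅ := by
  refine eq_empty_of_forall_notMem fun y hy => ?_
  rw [Jm_mem] at hy
  have h1 := hy 1 one_pos
  have h2 : ∑' k, muI (ball y 1 ∩ thickening (r k) {x}) ≤ ∑' k, ENNReal.ofReal (2 * r k) := by
    refine ENNReal.tsum_le_tsum fun k => ?_
    refine (Measure.restrict_apply_le _ _).trans ?_
    refine (measure_mono inter_subset_right).trans ?_
    rw [thickening_singleton, Real.volume_ball]
  rw [h1] at h2
  exact (hsum.mul_left 2).tsum_ofReal_ne_top (top_unique h2)

/-- iterates -/
abbrev Jit (r : ℕ → ℝ) (n : ℕ) (A : Set ℝ) : Set ℝ := (fun A => Jball muI r 0 A)^[n] A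

theorem Jit_succ (r : ℕ → ℝ) (n : ℕ) (A : Set ℝ) :
    Jit r (n + 1) A = Jball muI r 0 (Jit r n A) := Function.iterate_succ_apply' _ _ _

theorem Jit_mono (r : ℕ → ℝ) (n : ℕ) : Monotone (Jit r n) := Jm_mono.iterate n

theorem Jit_union (r : ℕ → ℝ) (n : ℕ) (A B : Set ℝ) :
    Jit r n (A ∪ B) ⊆ Jit r n A ∪ Jit r n B := by
  induction n with
  | zero => exact Subset.rfl
  | succ n ih =>
    simp only [Jit_succ]
    exact (Jm_mono ih).trans (Jm_union _ _)

theorem Jit_closed (r : ℕ → ℝ) (n : ℕ) {A : Set ℝ} (hA : IsClosed A) : IsClosed (Jit r n A) := by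
  cases n with
  | zero => exact hA
  | succ n => rw [Jit_succ]; exact Jm_closed _

theorem Jit_anti {r : ℕ → ℝ} (hsum : Summable r) {A : Set ℝ} (hA : IsClosed A) :
    Antitone (fun n => Jit r n A) := by
  refine antitone_nat_of_succ_le fun n => ?_
  rw [Jit_succ]
  exact Jm_sub hsum (Jit_closed r n hA)

theorem Jit_sub {r : ℕ → ℝ} (hsum : Summable r) (n : ℕ) {A : Set ℝ} (hA : IsClosed A) :
    Jit r n A ⊆ A := Jit_anti hsum hA (Nat.zero_le n)

/-- the sequence set -/
def glue (x : ℝ) (C : ℕ → Set ℝ) : Set ℝ := {x} ∪ ⋃ j, C j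

/-- base points offset -/
def off (j0 j : ℕ) : ℝ := 1 / ((j : ℝ) + j0 + 1)

theorem off_pos (j0 j : ℕ) : 0 < off j0 j := by unfold off; positivity

theorem off_anti (j0 : ℕ) {i j : ℕ} (h : i ≤ j) : off j0 j ≤ off j0 i := by
  unfold off
  have : (i : ℝ) ≤ j := by exact_mod_cast h
  gcongr

theorem off_tendsto (j0 : ℕ) : Tendsto (off j0) atTop (nhds 0) := by
  have := (tendsto_add_atTop_iff_nat j0).2 (tendsto_one_div_add_atTop_nhds_zero_nat (𝕜 := ℝ))
  refine this.congr fun j => ?_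
  simp [off]

theorem glue_sub {x : ℝ} {j0 : ℕ} {C : ℕ → Set ℝ}
    (hC : ∀ j, C j ⊆ Icc (x + off j0 j) (x + 2 * off j0 j)) (N : ℕ) :
    glue x C ⊆ (⋃ j ∈ Finset.range N, C j) ∪ Icc x (x + 2 * off j0 N) := by
  rintro y (hy | hy)
  · right
    have hy' : y = x := hy
    subst hy'
    have := off_pos j0 N
    constructor <;> linarith
  · obtain ⟨j, hj⟩ := mem_iUnion.1 hy
    by_cases h : j < N
    · left
      simp only [mem_iUnion, Finset.mem_range]
      exact ⟨j, h, hj⟩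
    · right
      have h1 := hC j hj
      have h2 := off_anti j0 (not_lt.1 h)
      have h3 := off_pos j0 j
      exact ⟨by linarith [h1.1], by linarith [h1.2]⟩

theorem glue_sup {x : ℝ} {j0 : ℕ} {C : ℕ → Set ℝ} {y : ℝ}
    (h : ∀ N, y ∈ (⋃ j ∈ Finset.range N, C j) ∪ Icc x (x + 2 * off j0 N)) : y ∈ glue x C := by
  by_contra hcon
  have hcon' : y ∉ ⋃ j, C j := fun h' => hcon (Or.inr h')
  have h2 : ∀ N, y ∈ Icc x (x + 2 * off j0 N) := by
    intro N
    refine (h N).resolve_left fun h3 => hcon' ?_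
    simp only [mem_iUnion] at h3 ⊢
    obtain ⟨j, _, hj⟩ := h3
    exact ⟨j, hj⟩
  have h3 : y ≤ x := by
    have h4 : Tendsto (fun N => x + 2 * off j0 N) atTop (nhds (x + 2 * 0)) :=
      ((off_tendsto j0).const_mul 2).const_add x
    have := ge_of_tendsto' h4 fun N => (h2 N).2
    linarith
  exact hcon (Or.inl (le_antisymm h3 (h2 0).1))

theorem glue_closed {x : ℝ} {j0 : ℕ} {C : ℕ → Set ℝ}
    (hC : ∀ j, C j ⊆ Icc (x + off j0 j) (x + 2 * off j0 j)) (hcl : ∀ j, IsClosed (C j)) :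
    IsClosed (glue x C) := by
  have : glue x C = ⋂ N, ((⋃ j ∈ Finset.range N, C j) ∪ Icc x (x + 2 * off j0 N)) := by
    apply Subset.antisymm
    · exact subset_iInter fun N => glue_sub hC N
    · intro y hy
      exact glue_sup (mem_iInter.1 hy)
  rw [this]
  refine isClosed_iInter fun N => IsClosed.union ?_ isClosed_Icc
  exact isClosed_biUnion_finset fun j _ => hcl j

theorem Jm_empty {r : ℕ → ℝ} (hsum : Summable r) : Jball muI r 0 ∅ = ∅ :=
  subset_empty_iff.1 (Jm_sub hsum isClosed_empty)

theorem Jit_biUnion {r : ℕ → ℝ} (hsum : Summable r) (n : ℕ) (C : ℕ → Set ℝ) (N : ℕ) :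
    Jit r n (⋃ j ∈ Finset.range N, C j) ⊆ ⋃ j ∈ Finset.range N, Jit r n (C j) := by
  induction N with
  | zero =>
    simp only [Finset.range_zero, Finset.notMem_empty, iUnion_of_empty, iUnion_empty]
    exact Jit_sub hsum n isClosed_empty
  | succ N ih =>
    simp only [Finset.range_add_one, Finset.set_biUnion_insert]
    exact (Jit_union r n _ _).trans (union_subset_union_right _ ih)

theorem Jit_glue {r : ℕ → ℝ} (hsum : Summable r) (n : ℕ) {x : ℝ} {j0 : ℕ} {C : ℕ → Set ℝ}
    (hC : ∀ j, C j ⊆ Icc (x + off j0 j) (x + 2 * off j0 j)) :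
    Jit r n (glue x C) ⊆ glue x (fun j => Jit r n (C j)) := by
  intro y hy
  refine glue_sup (j0 := j0) fun N => ?_
  have h1 := Jit_union r n _ _ (Jit_mono r n (glue_sub hC N) hy)
  exact h1.imp (fun h => Jit_biUnion hsum n C N h) (fun h => Jit_sub hsum n isClosed_Icc h)

theorem Jm_seq {r : ℕ → ℝ} (hrpos : ∀ k, 0 < r k)
    (hsum : Summable r) (hsqrt : ¬ Summable fun k => Real.sqrt (r k))
    {x : ℝ} (hx0 : 0 ≤ x) (hx1 : x < 1) (j0 : ℕ) :
    x ∈ Jball muI r 0 (⋃ j, {x + off j0 j}) := by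
  rw [Jm_mem]
  intro ρ hρ
  by_contra htop
  apply hsqrt
  have hlim : Tendsto (fun k => Real.sqrt (r k)) atTop (nhds 0) := by
    have := (Real.continuous_sqrt.tendsto 0).comp hsum.tendsto_atTop_zero
    rw [Real.sqrt_zero] at this
    exact this
  have hev : ∀ᶠ k in atTop, Real.sqrt (r k) < min ρ (min (1 - x) (1 / ((j0 : ℝ) + 1))) := by
    refine hlim.eventually (gt_mem_nhds ?_)
    refine lt_min hρ (lt_min (by linarith) (by positivity))
  have hS := ENNReal.summable_toReal htop
  refine Summable.of_norm_bounded_eventually_nat hS ?_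
  filter_upwards [hev] with k hk
  obtain ⟨hk1, hk'⟩ := lt_min_iff.1 hk
  obtain ⟨hk2, hk3⟩ := lt_min_iff.1 hk'
  have hnn := Real.sqrt_nonneg (r k)
  rw [Real.norm_of_nonneg hnn]
  rw [← ENNReal.ofReal_le_iff_le_toReal (measure_ne_top _ _)]
  have hvol : volume (Ioo x (x + Real.sqrt (r k))) = ENNReal.ofReal (Real.sqrt (r k)) := by
    rw [Real.volume_Ioo]; congr 1; ring
  rw [← hvol]
  have hrest : muI (Ioo x (x + Real.sqrt (r k))) = volume (Ioo x (x + Real.sqrt (r k))) := by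
    refine Measure.restrict_eq_self _ ?_
    intro y hy
    exact ⟨by linarith [hy.1], by linarith [hy.2]⟩
  rw [← hrest]
  refine measure_mono ?_
  intro y hy
  obtain ⟨hy1, hy2⟩ := hy
  refine ⟨?_, ?_⟩
  · rw [mem_ball, Real.dist_eq, abs_lt]
    constructor <;> linarith
  · obtain ⟨u, rfl⟩ : ∃ u, y = x + u := ⟨y - x, by ring⟩
    have hu : 0 < u := by linarith
    have hus : u < Real.sqrt (r k) := by linarith
    have huu : u * u < r k := by
      have := Real.mul_self_sqrt (hrpos k).le
      nlinarith
    set m := ⌊1 / u⌋₊ with hm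
    have hm1 : (m : ℝ) ≤ 1 / u := Nat.floor_le (by positivity)
    have hm2 : 1 / u < (m : ℝ) + 1 := Nat.lt_floor_add_one _
    have hj : j0 ≤ m := by
      rw [hm]
      apply Nat.le_floor
      rw [le_div_iff₀ hu]
      have h1 : u < 1 / ((j0 : ℝ) + 1) := hus.trans hk3
      rw [lt_div_iff₀ (by positivity)] at h1
      nlinarith
    rw [mem_thickening_iff]
    refine ⟨x + off j0 (m - j0), mem_iUnion.2 ⟨m - j0, rfl⟩, ?_⟩
    have hoff : off j0 (m - j0) = 1 / ((m : ℝ) + 1) := by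
      unfold off; rw [Nat.cast_sub hj]; congr 1; ring
    rw [hoff, Real.dist_eq]
    have hmp : (0 : ℝ) < (m : ℝ) + 1 := by positivity
    have e1 : 1 < ((m : ℝ) + 1) * u := by rwa [div_lt_iff₀ hu] at hm2
    have e2 : (m : ℝ) * u ≤ 1 := by rwa [le_div_iff₀ hu] at hm1
    have e3 : 1 / ((m : ℝ) + 1) < u := by
      rw [div_lt_iff₀ hmp]; linarith
    have e4 : u - 1 / ((m : ℝ) + 1) ≤ u * u := by
      have h5 : u * (1 - u) ≤ 1 / ((m : ℝ) + 1) := by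
        rw [le_div_iff₀ hmp]
        nlinarith
      linarith
    rw [abs_lt]
    constructor <;> linarith [hrpos k]

theorem exists_rank {r : ℕ → ℝ} (hrpos : ∀ k, 0 < r k)
    (hsum : Summable r) (hsqrt : ¬ Summable fun k => Real.sqrt (r k)) (n : ℕ) :
    ∀ x : ℝ, 0 ≤ x → x < 1 → ∀ ε > 0, ∃ C : Set ℝ, C ⊆ Icc x (x + ε) ∧ IsClosed C ∧
      Jit r n C = {x} := by
  induction n with
  | zero =>
    intro x _ _ ε hε
    refine ⟨{x}, ?_, isClosed_singleton, rfl⟩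
    rw [singleton_subset_iff]
    constructor <;> linarith
  | succ n ih =>
    intro x hx0 hx1 ε hε
    obtain ⟨j0, hj0⟩ : ∃ j0 : ℕ, off j0 0 < min (ε / 2) (1 - x) := by
      obtain ⟨j0, h⟩ := exists_nat_one_div_lt (lt_min (half_pos hε) (sub_pos.2 hx1))
      exact ⟨j0, by simpa [off] using h⟩
    obtain ⟨h1, h2⟩ := lt_min_iff.1 hj0
    have hstep : ∀ j, ∃ C : Set ℝ, C ⊆ Icc (x + off j0 j) (x + off j0 j + off j0 j) ∧ IsClosed C ∧
        Jit r n C = {x + off j0 j} := by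
      intro j
      have := off_pos j0 j
      have := off_anti j0 (Nat.zero_le j)
      exact ih _ (by linarith) (by linarith) _ (off_pos j0 j)
    choose C hC1 hC2 hC3 using hstep
    have hC : ∀ j, C j ⊆ Icc (x + off j0 j) (x + 2 * off j0 j) := by
      intro j
      refine (hC1 j).trans (Icc_subset_Icc le_rfl (by linarith))
    refine ⟨glue x C, ?_, glue_closed hC hC2, ?_⟩
    · refine (glue_sub hC 0).trans ?_
      simp only [Finset.range_zero, Finset.notMem_empty, iUnion_of_empty, iUnion_empty,
        empty_union]
      exact Icc_subset_Icc le_rfl (by linarith)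
    · rw [Jit_succ]
      apply Subset.antisymm
      · have h3 := Jit_glue hsum n hC
        simp only [hC3] at h3
        have h4 := Jm_mono (r := r) h3
        refine h4.trans ?_
        have h5 := Jit_glue (r := r) hsum 1 (x := x) (j0 := j0) (C := fun j => {x + off j0 j}) ?_
        · refine h5.trans ?_
          rintro y (hy | hy)
          · exact hy
          · obtain ⟨j, hj⟩ := mem_iUnion.1 hy
            have hj' : y ∈ Jball muI r 0 {x + off j0 j} := hj
            rw [Jm_singleton hrpos hsum] at hj'
            exact hj'.elim
        · intro j
          rw [singleton_subset_iff]
          have := off_pos j0 j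
          constructor <;> linarith
      · rw [singleton_subset_iff]
        refine Jm_mono ?_ (Jm_seq hrpos hsum hsqrt hx0 hx1 j0)
        refine iUnion_subset fun j => ?_
        rw [← hC3 j]
        exact Jit_mono r n ((subset_iUnion C j).trans subset_union_right)

/-- **Lemma 5.1** and the discussion following it: for a decreasing positive sequence `r`
with `∑ r_k < ∞` and `∑ √r_k = ∞`, there is a compact set `K ⊆ [0,1]` whose iterates under
the hitting operator `J^{L₁}_r` satisfy `⋂_{n≥1} (J^{L₁}_r)ⁿ(K) = {0}`; since moreover
`J^{L₁}_r({0}) = ∅`, the transfinite iteration starting from `K` does not stabilize after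
finitely many or even `ω` many steps. -/
theorem iteration_needs_more_than_omega_steps
    (r : ℕ → ℝ) (hrpos : ∀ k, 0 < r k) (hrdec : Antitone r)
    (hsum : Summable r) (hsqrt : ¬ Summable fun k => Real.sqrt (r k)) :
    ∃ K : Set ℝ, K ⊆ Icc (0 : ℝ) 1 ∧ IsCompact K ∧
      (⋂ n : ℕ, (fun A => Jball (volume.restrict (Icc (0 : ℝ) 1)) r 0 A)^[n + 1] K)
        = {(0 : ℝ)} ∧
      Jball (volume.restrict (Icc (0 : ℝ) 1)) r 0 {(0 : ℝ)} = ∅ := by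
  have hstep : ∀ j, ∃ C : Set ℝ, C ⊆ Icc (0 + off 2 j) (0 + off 2 j + off 2 j) ∧ IsClosed C ∧
      Jit r j C = {0 + off 2 j} := by
    intro j
    have h1 := off_pos 2 j
    have h2 := off_anti 2 (Nat.zero_le j)
    have h3 : off 2 0 = 1 / 3 := by norm_num [off]
    exact exists_rank hrpos hsum hsqrt j _ (by linarith) (by linarith) _ (off_pos 2 j)
  choose C hC1 hC2 hC3 using hstep
  have hC : ∀ j, C j ⊆ Icc (0 + off 2 j) (0 + 2 * off 2 j) := by
    intro j
    refine (hC1 j).trans (Icc_subset_Icc le_rfl (by linarith))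
  have hcl := glue_closed hC hC2
  have hsub : glue 0 C ⊆ Icc (0 : ℝ) 1 := by
    refine (glue_sub hC 0).trans ?_
    simp only [Finset.range_zero, Finset.notMem_empty, iUnion_of_empty, iUnion_empty,
      empty_union]
    have h3 : off 2 0 = 1 / 3 := by norm_num [off]
    exact Icc_subset_Icc le_rfl (by linarith)
  refine ⟨glue 0 C, hsub, isCompact_Icc.of_isClosed_subset hcl hsub, ?_,
    Jm_singleton hrpos hsum 0⟩
  change (⋂ n : ℕ, Jit r (n + 1) (glue 0 C)) = {(0 : ℝ)}
  apply Subset.antisymm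
  · intro y hy
    by_contra hy0
    have hb : ∀ n, y ≤ 2 * off 2 n := by
      intro n
      rcases Jit_glue hsum (n + 1) hC (mem_iInter.1 hy n) with h | h
      · exact (hy0 h).elim
      · obtain ⟨j, hj⟩ := mem_iUnion.1 h
        have hnj : n ≤ j := by
          by_contra hlt
          have h1 : Jit r (n + 1) (C j) ⊆ Jit r (j + 1) (C j) :=
            Jit_anti hsum (hC2 j) (by omega)
          have h2 := h1 hj
          rw [Jit_succ, hC3, Jm_singleton hrpos hsum] at h2
          exact h2
        have h4 := (hC j (Jit_sub hsum _ (hC2 j) hj)).2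
        linarith [off_anti 2 hnj]
    have h5 : y ≤ 0 := by
      have h6 := ge_of_tendsto' ((off_tendsto 2).const_mul 2) hb
      linarith
    have h7 : 0 ≤ y := (hsub (Jit_sub hsum _ hcl (mem_iInter.1 hy 0))).1
    exact hy0 (le_antisymm h5 h7)
  · rw [singleton_subset_iff, mem_iInter]
    intro n
    refine (Jit_closed r (n + 1) hcl).mem_of_tendsto (off_tendsto 2) ?_
    filter_upwards [eventually_ge_atTop (n + 1)] with j hj
    have h1 : off 2 j ∈ Jit r j (C j) := by rw [hC3]; simp
    exact Jit_mono r (n + 1) ((subset_iUnion C j).trans subset_union_right)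
      (Jit_anti hsum (hC2 j) hj h1)

end
end
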